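/- Define N_cr(M) by N_cr = Σ_{j≥1} q_j/(e^{βj}−1) where β > 0 is the unique positive root of Σ_{j≥1} j q_j/(e^{βj}−1) = M (with q_j = [j^{1/2}]). Then as M → ∞, N_cr ∼ M^{3/5} Γ(3/2)ζ(3/2) / (Γ(5/2)ζ(5/2))^{3/5}. -/

import Mathlib

open Real Filter

/-- General term of the series. -/
noncomputable def crTerm (k : ℕ) (b : ℝ) (j : ℕ) : ℝ :=
  ((j + 1 : ℕ) : ℝ) ^ k * (⌊Real.sqrt ((j + 1 : ℕ) : ℝ)⌋₊ : ℝ) /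
    (Real.exp (b * ((j + 1 : ℕ) : ℝ)) - 1)

lemma cr_zeta_sum (s : ℝ) (hs : 1 < s) :
    Summable (fun n : ℕ => 1 / ((n : ℝ) + 1) ^ s) ∧
    riemannZeta (s : ℂ) = ((∑' n : ℕ, 1 / ((n : ℝ) + 1) ^ s : ℝ) : ℂ) := by
  constructor
  · have := (summable_nat_add_iff 1).2 (Real.summable_one_div_nat_rpow.2 hs)
    simpa using this
  · rw [zeta_eq_tsum_one_div_nat_add_one_cpow (by simpa using hs), Complex.ofReal_tsum]
    congr 1 with n
    push_cast
    rw [Complex.ofReal_cpow (by positivity)]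
    norm_cast

lemma cr_zeta_pos (s : ℝ) (hs : 1 < s) : 0 < (riemannZeta (s : ℂ)).re := by
  obtain ⟨h1, h2⟩ := cr_zeta_sum s hs
  rw [h2, Complex.ofReal_re]
  exact h1.tsum_pos (fun n => by positivity) 0 (by norm_num)

lemma cr_integral (s : ℝ) (hs : 1 < s) :
    ∫ x in Set.Ioi (0:ℝ), x ^ (s - 1) / (Real.exp x - 1)
      = Real.Gamma s * (riemannZeta (s : ℂ)).re := by
  obtain ⟨h1, h2⟩ := cr_zeta_sum s hs
  have key := hasSum_mellin (ι := ℕ) (a := fun _ => 1) (p := fun n => (n : ℝ) + 1)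
    (F := fun t => ((1 / (Real.exp t - 1) : ℝ) : ℂ)) (s := (s : ℂ))
    (fun i => Or.inr (by positivity)) (by simp; linarith) ?_ (by simpa using h1)
  · have e1 : mellin (fun t => ((1 / (Real.exp t - 1) : ℝ) : ℂ)) (s : ℂ)
        = ((∫ x in Set.Ioi (0:ℝ), x ^ (s - 1) / (Real.exp x - 1) : ℝ) : ℂ) := by
      rw [mellin, ← integral_complex_ofReal]
      refine MeasureTheory.setIntegral_congr_fun measurableSet_Ioi (fun x hx => ?_)
      have hx' : (0:ℝ) ≤ x := le_of_lt hx
      simp only [smul_eq_mul]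
      rw [show (s : ℂ) - 1 = ((s - 1 : ℝ) : ℂ) by push_cast; rfl, ← Complex.ofReal_cpow hx',
        ← Complex.ofReal_mul]
      congr 1
      ring
    have e2 := key.tsum_eq
    rw [e1] at e2
    apply Complex.ofReal_injective
    rw [← e2, h2, Complex.ofReal_re, Complex.ofReal_mul, Complex.ofReal_tsum, ← tsum_mul_left]
    congr 1 with n
    rw [Complex.Gamma_ofReal]
    have : (((n:ℝ) + 1 : ℝ) : ℂ) ^ (s : ℂ) = ((((n:ℝ) + 1) ^ s : ℝ) : ℂ) := by
      rw [Complex.ofReal_cpow (by positivity)]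
    rw [this]
    push_cast
    ring
  · intro t ht
    have ht : 0 < t := ht
    have hlt : Real.exp (-t) < 1 := by simpa using ht
    have hg := (hasSum_geometric_of_lt_one (Real.exp_pos (-t)).le hlt).mul_left (Real.exp (-t))
    have hg2 := Complex.hasSum_ofReal.2 hg
    have hne : Real.exp t - 1 ≠ 0 := by
      have := Real.add_one_lt_exp ht.ne'
      linarith
    convert! hg2 using 1
    · ext n
      rw [one_mul, ← Real.exp_nat_mul, ← Real.exp_add]
      congr 2
      ring
    · congr 1
      rw [Real.exp_neg]
      have := Real.exp_pos t
      have h3 : 1 - (Real.exp t)⁻¹ ≠ 0 := by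
        rw [← Real.exp_neg]; linarith
      field_simp

lemma cr_floor_integral (b : ℝ) (hb : 0 < b) (h : ℕ → ℝ)
    (hi : MeasureTheory.IntegrableOn (fun x : ℝ => h ⌊x / b⌋₊) (Set.Ici 0)) :
    HasSum (fun n => b * h n) (∫ x in Set.Ici (0:ℝ), h ⌊x / b⌋₊) := by
  have hU : (⋃ n : ℕ, Set.Ico (b * n) (b * (n + 1))) = Set.Ici (0:ℝ) := by
    ext x
    simp only [Set.mem_iUnion, Set.mem_Ico, Set.mem_Ici]
    constructor
    · rintro ⟨n, h1, h2⟩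
      exact le_trans (by positivity) h1
    · intro hx
      refine ⟨⌊x / b⌋₊, ?_, ?_⟩
      · have := Nat.floor_le (div_nonneg hx hb.le)
        rw [le_div_iff₀ hb] at this
        linarith
      · have := Nat.lt_floor_add_one (x / b)
        rw [div_lt_iff₀ hb] at this
        linarith
  have hfl : ∀ (n : ℕ) (x : ℝ), x ∈ Set.Ico (b * n) (b * (n + 1)) → ⌊x / b⌋₊ = n := by
    intro n x hx
    have hx0 : 0 ≤ x := le_trans (by positivity) hx.1
    rw [Nat.floor_eq_iff (div_nonneg hx0 hb.le), le_div_iff₀ hb, div_lt_iff₀ hb]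
    constructor
    · linarith [hx.1]
    · linarith [hx.2]
  have hd : Pairwise (Function.onFun Disjoint fun n : ℕ => Set.Ico (b * n) (b * ((n:ℝ) + 1))) := by
    intro m n hmn
    refine Set.disjoint_left.2 fun x hx hy => hmn ?_
    rw [← hfl m x hx, ← hfl n x hy]
  have := MeasureTheory.hasSum_integral_iUnion (μ := MeasureTheory.volume)
    (f := fun x : ℝ => h ⌊x / b⌋₊)
    (fun n : ℕ => measurableSet_Ico (a := b * n) (b := b * ((n:ℝ) + 1))) hd (by rwa [hU])
  rw [hU] at this
  convert! this using 1
  ext n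
  rw [MeasureTheory.setIntegral_congr_fun measurableSet_Ico
    (g := fun _ => h n) (fun x hx => by simp only [hfl n x hx])]
  simp [MeasureTheory.integral_const, MeasureTheory.Measure.real, hb.le, mul_add]

lemma cr_exp_bound (y : ℝ) (hy : 0 < y) : y * Real.exp (y / 2) ≤ Real.exp y - 1 := by
  have h1 : y / 2 ≤ Real.sinh (y / 2) := Real.self_le_sinh_iff.2 (by positivity)
  rw [Real.sinh_eq] at h1
  have h2 : y ≤ Real.exp (y / 2) - Real.exp (-(y / 2)) := by linarith
  calc y * Real.exp (y / 2) ≤ (Real.exp (y / 2) - Real.exp (-(y / 2))) * Real.exp (y / 2) := by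
        gcongr
    _ = Real.exp y - 1 := by
        rw [sub_mul, ← Real.exp_add, ← Real.exp_add]
        simp

lemma cr_pow_bound (k : ℕ) (hk : k ≤ 1) (y : ℝ) (hy : 0 < y) : y ^ k ≤ 4 * Real.exp (y / 4) := by
  have := Real.add_one_le_exp (y / 4)
  interval_cases k
  · simp; linarith
  · simp; linarith

/-- Rewriting of the rescaled step function. -/
lemma cr_step_eq (k : ℕ) (b : ℝ) (n : ℕ) :
    b ^ k * √b * crTerm k b n =
      (b * ((n + 1 : ℕ) : ℝ)) ^ k * (√b * (⌊√((n + 1 : ℕ) : ℝ)⌋₊ : ℝ)) /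
        (Real.exp (b * ((n + 1 : ℕ) : ℝ)) - 1) := by
  rw [crTerm, mul_pow]
  ring

lemma cr_bound (k : ℕ) (hk : k ≤ 1) (b : ℝ) (hb : 0 < b) (x : ℝ) (hx : 0 < x) :
    ‖b ^ k * √b * crTerm k b ⌊x / b⌋₊‖ ≤
      4 * (x ^ (-(1/2) : ℝ) * Real.exp (-(1/4) * x ^ (1:ℝ))) := by
  rw [cr_step_eq]
  set n := ⌊x / b⌋₊
  set y := b * ((n + 1 : ℕ) : ℝ) with hy
  have hxy : x < y := by
    have := Nat.lt_floor_add_one (x / b)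
    rw [div_lt_iff₀ hb] at this
    rw [hy]; push_cast; linarith
  have hy0 : 0 < y := hx.trans hxy
  have hE := cr_exp_bound y hy0
  have hE0 : 0 < y * Real.exp (y / 2) := by positivity
  have hE1 : 0 < Real.exp y - 1 := by linarith
  rw [Real.norm_of_nonneg (by positivity)]
  have hsq : √b * (⌊√((n + 1 : ℕ) : ℝ)⌋₊ : ℝ) ≤ √y := by
    rw [hy, Real.sqrt_mul hb.le]
    gcongr
    exact Nat.floor_le (by positivity)
  calc _ ≤ 4 * Real.exp (y / 4) * √y / (y * Real.exp (y / 2)) := by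
        gcongr
        exact cr_pow_bound k hk y hy0
    _ = 4 * (y ^ (-(1/2) : ℝ) * Real.exp (-(1/4) * y)) := by
        rw [Real.rpow_neg hy0.le, ← Real.sqrt_eq_rpow]
        have e1 : Real.exp (y / 2) = Real.exp (y / 4) * Real.exp (y / 4) := by
          rw [← Real.exp_add]; ring_nf
        have e2 : Real.exp (-(1/4) * y) = (Real.exp (y / 4))⁻¹ := by
          rw [← Real.exp_neg]; ring_nf
        have e3 : √y * √y = y := Real.mul_self_sqrt hy0.le
        have e4 : 0 < √y := Real.sqrt_pos.2 hy0
        rw [e1, e2]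
        field_simp
        nlinarith
    _ ≤ _ := by
        rw [Real.rpow_one]
        have : y ^ (-(1/2) : ℝ) ≤ x ^ (-(1/2) : ℝ) :=
          Real.rpow_le_rpow_of_nonpos hx hxy.le (by norm_num)
        have h2 : Real.exp (-(1/4) * y) ≤ Real.exp (-(1/4) * x) :=
          Real.exp_le_exp.2 (by linarith)
        gcongr

lemma cr_bound_int : MeasureTheory.IntegrableOn
    (fun x : ℝ => 4 * (x ^ (-(1/2) : ℝ) * Real.exp (-(1/4) * x ^ (1:ℝ)))) (Set.Ioi 0) :=
  (integrableOn_rpow_mul_exp_neg_mul_rpow (by norm_num) one_pos (by norm_num)).const_mul 4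

lemma cr_meas (k : ℕ) (b : ℝ) :
    Measurable (fun x : ℝ => b ^ k * √b * crTerm k b ⌊x / b⌋₊) := by
  have h : Measurable (fun n : ℕ => b ^ k * √b * crTerm k b n) := measurable_from_nat
  exact h.comp (Nat.measurable_floor.comp (measurable_id.div_const b))

lemma cr_hasSum (k : ℕ) (hk : k ≤ 1) (b : ℝ) (hb : 0 < b) :
    HasSum (fun n => b * (b ^ k * √b * crTerm k b n))
      (∫ x in Set.Ioi (0:ℝ), b ^ k * √b * crTerm k b ⌊x / b⌋₊) := by
  rw [← MeasureTheory.integral_Ici_eq_integral_Ioi]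
  refine cr_floor_integral b hb (fun n => b ^ k * √b * crTerm k b n) ?_
  rw [integrableOn_Ici_iff_integrableOn_Ioi]
  refine cr_bound_int.mono' (cr_meas k b).aestronglyMeasurable ?_
  refine (MeasureTheory.ae_restrict_iff' measurableSet_Ioi).2 (Filter.Eventually.of_forall ?_)
  exact fun x hx => cr_bound k hk b hb x hx

lemma cr_summable (k : ℕ) (hk : k ≤ 1) (b : ℝ) (hb : 0 < b) : Summable (crTerm k b) := by
  have h := (cr_hasSum k hk b hb).summable
  have hb2 := Real.sqrt_pos.2 hb
  have h2 : b * (b ^ k * √b) ≠ 0 := by positivity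
  refine (summable_mul_left_iff h2).1 (h.congr fun n => ?_)
  ring

lemma cr_pointwise (k : ℕ) (x : ℝ) (hx : 0 < x) :
    Tendsto (fun b : ℝ => b ^ k * √b * crTerm k b ⌊x / b⌋₊) (nhdsWithin 0 (Set.Ioi 0))
      (nhds (x ^ k * √x / (Real.exp x - 1))) := by
  have hid : Tendsto (fun b : ℝ => b) (nhdsWithin 0 (Set.Ioi 0)) (nhds 0) :=
    tendsto_nhdsWithin_of_tendsto_nhds tendsto_id
  have hy : Tendsto (fun b : ℝ => b * ((⌊x / b⌋₊ + 1 : ℕ) : ℝ)) (nhdsWithin 0 (Set.Ioi 0))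
      (nhds x) := by
    have hu : Tendsto (fun b : ℝ => x + b) (nhdsWithin 0 (Set.Ioi 0)) (nhds x) := by
      simpa using hid.const_add x
    refine tendsto_of_tendsto_of_tendsto_of_le_of_le' tendsto_const_nhds hu ?_ ?_
    · filter_upwards [self_mem_nhdsWithin] with b hb
      have hb : 0 < b := hb
      have := Nat.lt_floor_add_one (x / b)
      rw [div_lt_iff₀ hb] at this
      push_cast; linarith
    · filter_upwards [self_mem_nhdsWithin] with b hb
      have hb : 0 < b := hb
      have := Nat.floor_le (div_nonneg hx.le hb.le)
      rw [le_div_iff₀ hb] at this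
      push_cast; linarith
  have hsb : Tendsto (fun b : ℝ => √b) (nhdsWithin 0 (Set.Ioi 0)) (nhds 0) := by
    simpa using hid.sqrt
  have hq : Tendsto (fun b : ℝ => √b * (⌊√((⌊x / b⌋₊ + 1 : ℕ) : ℝ)⌋₊ : ℝ))
      (nhdsWithin 0 (Set.Ioi 0)) (nhds (√x)) := by
    have hl : Tendsto (fun b : ℝ => √(b * ((⌊x / b⌋₊ + 1 : ℕ) : ℝ)) - √b)
        (nhdsWithin 0 (Set.Ioi 0)) (nhds (√x)) := by
      simpa using hy.sqrt.sub hsb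
    refine tendsto_of_tendsto_of_tendsto_of_le_of_le' hl hy.sqrt ?_ ?_
    · filter_upwards [self_mem_nhdsWithin] with b hb
      have hb : 0 < b := hb
      rw [Real.sqrt_mul hb.le]
      have := Nat.lt_floor_add_one (√((⌊x / b⌋₊ + 1 : ℕ) : ℝ))
      nlinarith [Real.sqrt_nonneg b]
    · filter_upwards [self_mem_nhdsWithin] with b hb
      have hb : 0 < b := hb
      rw [Real.sqrt_mul hb.le]
      gcongr
      exact Nat.floor_le (by positivity)
  simp_rw [cr_step_eq]
  have hne : Real.exp x - 1 ≠ 0 := by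
    have := Real.add_one_lt_exp hx.ne'
    linarith
  exact ((hy.pow k).mul hq).div (((Real.continuous_exp.tendsto x).comp hy).sub_const 1) hne

lemma cr_asymp (k : ℕ) (hk : k ≤ 1) :
    Tendsto (fun b : ℝ => b ^ ((k : ℝ) + 3/2) * ∑' j, crTerm k b j) (nhdsWithin 0 (Set.Ioi 0))
      (nhds (Real.Gamma ((k : ℝ) + 3/2) * (riemannZeta (((k : ℝ) + 3/2 : ℝ) : ℂ)).re)) := by
  have hk0 : (0:ℝ) ≤ k := Nat.cast_nonneg k
  rw [← cr_integral _ (by linarith)]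
  have h1 : Tendsto (fun b : ℝ => ∫ x in Set.Ioi (0:ℝ), b ^ k * √b * crTerm k b ⌊x / b⌋₊)
      (nhdsWithin 0 (Set.Ioi 0))
      (nhds (∫ x in Set.Ioi (0:ℝ), x ^ k * √x / (Real.exp x - 1))) := by
    refine MeasureTheory.tendsto_integral_filter_of_dominated_convergence _ ?_ ?_ cr_bound_int ?_
    · exact Filter.Eventually.of_forall fun b => (cr_meas k b).aestronglyMeasurable
    · filter_upwards [self_mem_nhdsWithin] with b hb
      refine (MeasureTheory.ae_restrict_iff' measurableSet_Ioi).2 (Filter.Eventually.of_forall ?_)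
      exact fun x hx => cr_bound k hk b hb x hx
    · refine (MeasureTheory.ae_restrict_iff' measurableSet_Ioi).2 (Filter.Eventually.of_forall ?_)
      exact fun x hx => cr_pointwise k x hx
  have e : ∫ x in Set.Ioi (0:ℝ), x ^ ((k : ℝ) + 3/2 - 1) / (Real.exp x - 1)
      = ∫ x in Set.Ioi (0:ℝ), x ^ k * √x / (Real.exp x - 1) := by
    refine MeasureTheory.setIntegral_congr_fun measurableSet_Ioi (fun x hx => ?_)
    have hx : 0 < x := hx
    rw [show (k : ℝ) + 3/2 - 1 = k + 1/2 by ring, Real.rpow_add hx, Real.rpow_natCast,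
      Real.sqrt_eq_rpow]
  rw [e]
  refine h1.congr' ?_
  filter_upwards [self_mem_nhdsWithin] with b hb
  have hb : 0 < b := hb
  rw [← (cr_hasSum k hk b hb).tsum_eq, ← tsum_mul_left]
  congr 1 with n
  rw [show (k : ℝ) + 3/2 = k + 1/2 + 1 by ring, Real.rpow_add hb, Real.rpow_add hb,
    Real.rpow_natCast, Real.sqrt_eq_rpow, Real.rpow_one]
  ring

lemma cr_anti (k : ℕ) (hk : k ≤ 1) (a b : ℝ) (ha : 0 < a) (hab : a ≤ b) :
    ∑' j, crTerm k b j ≤ ∑' j, crTerm k a j := by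
  refine (cr_summable k hk b (ha.trans_le hab)).tsum_le_tsum (fun n => ?_) (cr_summable k hk a ha)
  unfold crTerm
  have h0 : 0 < Real.exp (a * ((n + 1 : ℕ) : ℝ)) - 1 := by
    have : 0 < a * ((n + 1 : ℕ) : ℝ) := by positivity
    linarith [Real.add_one_lt_exp this.ne']
  gcongr

/-- If β(M) > 0 solves Σ_j j⌊√j⌋/(e^{β j}−1) = M and
N_cr(M) = Σ_j ⌊√j⌋/(e^{β(M) j}−1), then as M → ∞,
N_cr(M) ∼ M^{3/5} Γ(3/2)ζ(3/2)/(Γ(5/2)ζ(5/2))^{3/5}. -/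
theorem Ncr_asymptotic (β : ℝ → ℝ)
    (hβpos : ∀ M : ℝ, 0 < M → 0 < β M)
    (hβ : ∀ M : ℝ, 0 < M →
      (∑' j : ℕ, ((j + 1 : ℕ) : ℝ) * (⌊Real.sqrt ((j + 1 : ℕ) : ℝ)⌋₊ : ℝ) /
          (Real.exp (β M * ((j + 1 : ℕ) : ℝ)) - 1)) = M) :
    Filter.Tendsto
      (fun M : ℝ =>
        (∑' j : ℕ, (⌊Real.sqrt ((j + 1 : ℕ) : ℝ)⌋₊ : ℝ) /
            (Real.exp (β M * ((j + 1 : ℕ) : ℝ)) - 1)) /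
          (M ^ ((3:ℝ)/5) * (Real.Gamma (3/2) * (riemannZeta (3/2)).re) /
            (Real.Gamma (5/2) * (riemannZeta (5/2)).re) ^ ((3:ℝ)/5)))
      Filter.atTop (nhds 1) := by
  have e0 : ∀ b : ℝ, (∑' j : ℕ, (⌊Real.sqrt ((j + 1 : ℕ) : ℝ)⌋₊ : ℝ) /
      (Real.exp (b * ((j + 1 : ℕ) : ℝ)) - 1)) = ∑' j, crTerm 0 b j := by
    intro b; simp [crTerm]
  have e1 : ∀ b : ℝ, (∑' j : ℕ, ((j + 1 : ℕ) : ℝ) * (⌊Real.sqrt ((j + 1 : ℕ) : ℝ)⌋₊ : ℝ) /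
      (Real.exp (b * ((j + 1 : ℕ) : ℝ)) - 1)) = ∑' j, crTerm 1 b j := by
    intro b; simp [crTerm]
  simp only [e1] at hβ
  simp only [e0]
  have hb0 : Tendsto β atTop (nhdsWithin 0 (Set.Ioi 0)) := by
    refine tendsto_nhdsWithin_iff.2 ⟨?_, ?_⟩
    · refine tendsto_order.2 ⟨fun a ha => ?_, fun d hd => ?_⟩
      · filter_upwards [eventually_gt_atTop 0] with M hM
        exact ha.trans (hβpos M hM)
      · filter_upwards [eventually_gt_atTop 0, eventually_gt_atTop (∑' j, crTerm 1 d j)]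
          with M hM hM2
        by_contra hcon
        have := cr_anti 1 le_rfl d (β M) hd (not_lt.1 hcon)
        rw [hβ M hM] at this
        linarith
    · filter_upwards [eventually_gt_atTop 0] with M hM
      exact hβpos M hM
  have h0 := (cr_asymp 0 (by norm_num)).comp hb0
  have h1 := (cr_asymp 1 le_rfl).comp hb0
  have z0 := cr_zeta_pos (3/2) (by norm_num)
  have z1 := cr_zeta_pos (5/2) (by norm_num)
  have c0 : (((3/2 : ℝ)) : ℂ) = 3/2 := by push_cast; rfl
  have c1 : (((5/2 : ℝ)) : ℂ) = 5/2 := by push_cast; rfl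
  rw [show ((0:ℕ):ℝ) + 3/2 = 3/2 by norm_num] at h0
  rw [show ((1:ℕ):ℝ) + 3/2 = 5/2 by norm_num] at h1
  rw [c0] at h0 z0
  rw [c1] at h1 z1
  have p0 : 0 < Real.Gamma (3/2) * (riemannZeta (3/2)).re :=
    mul_pos (Real.Gamma_pos_of_pos (by norm_num)) z0
  have p1 : 0 < Real.Gamma (5/2) * (riemannZeta (5/2)).re :=
    mul_pos (Real.Gamma_pos_of_pos (by norm_num)) z1
  set A := Real.Gamma (3/2) * (riemannZeta (3/2)).re with hA
  set B := Real.Gamma (5/2) * (riemannZeta (5/2)).re with hB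
  have hBp : 0 < B ^ ((3:ℝ)/5) := Real.rpow_pos_of_pos p1 _
  have h1' := h1.rpow_const (p := (3:ℝ)/5) (Or.inl p1.ne')
  have hfin := (h0.div h1' hBp.ne').mul_const (B ^ ((3:ℝ)/5) / A)
  have hone : A / B ^ ((3:ℝ)/5) * (B ^ ((3:ℝ)/5) / A) = 1 := by field_simp
  rw [hone] at hfin
  refine hfin.congr' ?_
  filter_upwards [eventually_gt_atTop 0] with M hM
  have hb := hβpos M hM
  simp only [Function.comp, Pi.div_apply]
  rw [hβ M hM, Real.mul_rpow (by positivity) hM.le, ← Real.rpow_mul hb.le,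
    show (5/2 : ℝ) * (3/5) = 3/2 by norm_num]
  have q1 : 0 < β M ^ ((3:ℝ)/2) := Real.rpow_pos_of_pos hb _
  have q2 : 0 < M ^ ((3:ℝ)/5) := Real.rpow_pos_of_pos hM _
  field_simp
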